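/- If R is a multiplicity-free extension of a non-trivial finite group G by a two-element set T = {t₁, t₂}, then |G| is even. -/

import Mathlib

/-- A fusion ring, given by its finite basis `B`, unit, involution (dual) and
structure constants `N a b c` (the coefficient of `c` in `a × b`). -/
structure FusionData (B : Type*) [Fintype B] [DecidableEq B] where
  one : B
  dual : B → B
  N : B → B → B → ℕ
  dual_dual : ∀ a, dual (dual a) = a
  N_one_left : ∀ a c, N one a c = if a = c then 1 else 0
  N_one_right : ∀ a c, N a one c = if a = c then 1 else 0
  assoc : ∀ a b c d, ∑ e, N a b e * N e c d = ∑ f, N b c f * N a f d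
  dual_pair : ∀ a b, N a (dual b) one = if a = b then 1 else 0
  frob : ∀ a b c, N a b c = N (dual a) c b

/-- An extension of a finite group `G` by a finite set `T`: a fusion ring with
basis `G ⊔ T`, unit `1 ∈ G`, whose structure constants restrict to the group
multiplication on `G`. -/
structure GroupExt (G T : Type*) [Group G] [Fintype G] [DecidableEq G]
    [Fintype T] [DecidableEq T] extends FusionData (G ⊕ T) where
  one_def : one = Sum.inl 1
  mul_def : ∀ g h k : G, N (Sum.inl g) (Sum.inl h) (Sum.inl k) = if g * h = k then 1 else 0
  mul_t : ∀ (g h : G) (t : T), N (Sum.inl g) (Sum.inl h) (Sum.inr t) = 0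

/-- A `2 × 2` invertible matrix over `ℕ` is the identity or the swap, so it squares to `1`. -/
theorem Matrix.sq_eq_one_of_mul_eq_one_fin_two {A B : Matrix (Fin 2) (Fin 2) ℕ}
    (hA : ∀ i j, A i j ≤ 1) (hB : ∀ i j, B i j ≤ 1) (hAB : A * B = 1) : A ^ 2 = 1 := by
  have e : ∀ i j, (A * B) i j = (1 : Matrix (Fin 2) (Fin 2) ℕ) i j := fun i j => by rw [hAB]
  have h00 := e 0 0
  have h01 := e 0 1
  have h10 := e 1 0
  have h11 := e 1 1
  simp only [Matrix.mul_apply, Fin.sum_univ_two, Matrix.one_apply] at h00 h01 h10 h11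
  have a00 := hA 0 0
  have a01 := hA 0 1
  have a10 := hA 1 0
  have a11 := hA 1 1
  have b00 := hB 0 0
  have b01 := hB 0 1
  have b10 := hB 1 0
  have b11 := hB 1 1
  ext i j
  rw [sq]
  fin_cases i <;> fin_cases j <;>
    simp only [Matrix.mul_apply, Fin.sum_univ_two, Matrix.one_apply, Fin.zero_eta, Fin.mk_one] <;>
    generalize A 0 0 = p at * <;> generalize A 0 1 = q at * <;>
    generalize A 1 0 = r at * <;> generalize A 1 1 = s at * <;>
    interval_cases p <;> interval_cases q <;> interval_cases r <;> interval_cases s <;>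
    simp_all

/-- A group of odd order acts trivially by `2 × 2` zero-one matrices. -/
theorem eq_one_of_odd_card_of_monoidHom_matrix {G T : Type*} [Group G] [Fintype G] [Fintype T]
    [DecidableEq T] (hT : Fintype.card T = 2) (hG : Odd (Fintype.card G))
    (φ : G →* Matrix T T ℕ) (hφ : ∀ g s t, φ g s t ≤ 1) (g : G) : φ g = 1 := by
  let e : T ≃ Fin 2 := Fintype.equivFinOfCardEq hT
  have hsq : φ g ^ 2 = 1 := by
    apply (Matrix.reindexRingEquiv ℕ e).injective
    rw [map_pow, map_one]
    refine Matrix.sq_eq_one_of_mul_eq_one_fin_two (B := Matrix.reindexRingEquiv ℕ e (φ g⁻¹))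
      (fun i j => hφ _ _ _) (fun i j => hφ _ _ _) ?_
    rw [← map_mul, ← map_mul, mul_inv_cancel, map_one, map_one]
  have hcard : φ g ^ Fintype.card G = 1 := by rw [← map_pow, pow_card_eq_one, map_one]
  obtain ⟨k, hk⟩ := hG
  rwa [hk, pow_succ, pow_mul, hsq, one_pow, one_mul] at hcard

namespace GroupExt

variable {G T : Type*} [Group G] [Fintype G] [DecidableEq G] [Fintype T] [DecidableEq T]
  (E : GroupExt G T)

theorem N_one_inr (t s : T) :
    E.N (Sum.inl 1) (Sum.inr t) (Sum.inr s) = if t = s then 1 else 0 := by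
  simpa [E.one_def] using E.N_one_left (Sum.inr t) (Sum.inr s)

theorem N_inr_one (t s : T) :
    E.N (Sum.inr t) (Sum.inl 1) (Sum.inr s) = if t = s then 1 else 0 := by
  simpa [E.one_def] using E.N_one_right (Sum.inr t) (Sum.inr s)

theorem dual_inl (g : G) : E.dual (Sum.inl g) = Sum.inl g⁻¹ := by
  have h := E.dual_pair (Sum.inl g⁻¹) (E.dual (Sum.inl g))
  rw [E.dual_dual, E.one_def, E.mul_def] at h
  by_contra hne
  simp [Ne.symm hne] at h

theorem exists_dual_inr (t : T) : ∃ s, E.dual (Sum.inr t) = Sum.inr s := by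
  rcases h : E.dual (Sum.inr t) with g | s
  · have := E.dual_dual (Sum.inr t)
    rw [h, dual_inl] at this
    cases this
  · exact ⟨s, rfl⟩

theorem N_inl_inr_inl (g h : G) (t : T) : E.N (Sum.inl g) (Sum.inr t) (Sum.inl h) = 0 := by
  rw [E.frob, dual_inl, E.mul_t]

theorem N_inr_inl_inl (g h : G) (t : T) : E.N (Sum.inr t) (Sum.inl g) (Sum.inl h) = 0 := by
  have h1 := E.assoc (Sum.inr t) (Sum.inl g) (Sum.inl g⁻¹) (Sum.inl (h * g⁻¹))
  have h2 := E.N_one_right (Sum.inr t) (Sum.inl (h * g⁻¹))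
  rw [E.one_def] at h2
  simp only [Fintype.sum_sum_type, E.mul_def, E.mul_t, mul_inv_cancel, ite_mul, one_mul, zero_mul,
    Finset.sum_ite_eq, Finset.mem_univ, if_true, Finset.sum_const_zero, add_zero, h2,
    mul_left_inj, mul_ite, mul_one, mul_zero, Finset.sum_ite_eq', reduceCtorEq, if_false] at h1
  omega

/-- The action of `G` on `T` by left multiplication. -/
def leftAction : G →* Matrix T T ℕ where
  toFun g := Matrix.of fun s t => E.N (Sum.inl g) (Sum.inr t) (Sum.inr s)
  map_one' := by
    ext s t
    simp [N_one_inr, Matrix.one_apply, eq_comm]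
  map_mul' g h := by
    ext s t
    simpa [Matrix.mul_apply, E.mul_def, E.mul_t, N_inl_inr_inl, mul_comm] using
      E.assoc (Sum.inl g) (Sum.inl h) (Sum.inr t) (Sum.inr s)

/-- The action of `G` on `T` by right multiplication. -/
def rightAction : G →* Matrix T T ℕ where
  toFun g := Matrix.of fun t s => E.N (Sum.inr t) (Sum.inl g) (Sum.inr s)
  map_one' := by
    ext t s
    simp [N_inr_one, Matrix.one_apply]
  map_mul' g h := by
    ext t s
    simpa [Matrix.mul_apply, E.mul_def, E.mul_t, N_inr_inl_inl] using
      (E.assoc (Sum.inr t) (Sum.inl g) (Sum.inl h) (Sum.inr s)).symm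

/-- If `G` fixes `T` pointwise on both sides and `T` has two distinct elements `x`, `y`, comparing
the coefficients of `y` in `(x x̄) y = x (x̄ y)` bounds `|G|` by `|T|`. -/
theorem card_le_card_of_trivial_action (hmf : ∀ a b c : G ⊕ T, E.N a b c ≤ 1)
    (hl : ∀ g s t, E.N (Sum.inl g) (Sum.inr t) (Sum.inr s) = if s = t then 1 else 0)
    (hr : ∀ g t s, E.N (Sum.inr t) (Sum.inl g) (Sum.inr s) = if t = s then 1 else 0)
    {x y : T} (hxy : x ≠ y) : Fintype.card G ≤ Fintype.card T := by
  obtain ⟨z, hz⟩ := E.exists_dual_inr x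
  have hz' : E.dual (Sum.inr z) = Sum.inr x := by rw [← hz, E.dual_dual]
  have h1 : ∀ g : G, E.N (Sum.inr x) (Sum.inr z) (Sum.inl g) = 1 := fun g => by
    rw [E.frob, hz, hr, if_pos rfl]
  have h2 : ∀ g : G, E.N (Sum.inr z) (Sum.inr y) (Sum.inl g) = 0 := fun g => by
    rw [E.frob, hz', hr, if_neg hxy]
  have h := E.assoc (Sum.inr x) (Sum.inr z) (Sum.inr y) (Sum.inr y)
  simp only [Fintype.sum_sum_type, h1, h2, hl, if_true, mul_one, Finset.sum_const,
    Finset.card_univ, smul_eq_mul, zero_mul, mul_zero, zero_add] at h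
  calc Fintype.card G ≤ ∑ t : T, E.N (Sum.inr z) (Sum.inr y) (Sum.inr t) *
        E.N (Sum.inr x) (Sum.inr t) (Sum.inr y) := h ▸ Nat.le_add_right _ _
    _ ≤ ∑ _t : T, 1 := Finset.sum_le_sum fun t _ => Nat.mul_le_mul (hmf _ _ _) (hmf _ _ _)
    _ = Fintype.card T := by simp

end GroupExt

/-- If `R` is a multiplicity-free extension of a non-trivial finite
group `G` by a two-element set `T`, then `|G|` is even. -/
theorem multfree_two_particle_even {G T : Type*} [Group G] [Fintype G] [DecidableEq G]
    [Fintype T] [DecidableEq T] [Nonempty T] [Nontrivial G]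
    (hT : Fintype.card T = 2) (E : GroupExt G T)
    (hmf : ∀ a b c : G ⊕ T, E.N a b c ≤ 1) :
    Even (Fintype.card G) := by
  by_contra hodd
  rw [Nat.not_even_iff_odd] at hodd
  have hl := eq_one_of_odd_card_of_monoidHom_matrix hT hodd E.leftAction fun _ _ _ => hmf _ _ _
  have hr := eq_one_of_odd_card_of_monoidHom_matrix hT hodd E.rightAction fun _ _ _ => hmf _ _ _
  obtain ⟨x, y, hxy⟩ := Fintype.one_lt_card_iff.mp (hT ▸ one_lt_two)
  have hle := E.card_le_card_of_trivial_action hmf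
    (fun g s t => (congrFun₂ (hl g) s t).trans Matrix.one_apply)
    (fun g t s => (congrFun₂ (hr g) t s).trans Matrix.one_apply) hxy
  have hlt := Fintype.one_lt_card (α := G)
  obtain ⟨k, hk⟩ := hodd
  omega
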